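/- Let U and V be left finite modules in mod A with the same Newton polytope, N(U) = N(V). Then U and V generate the same torsion class: ⟨U⟩_tors = ⟨V⟩_tors. -/

import Mathlib

/-! Common definitions: finite-dimensional modules over a finite-dimensional algebra,
quotient modules, dimension vectors via composition series, Newton polytopes,
torsion classes, `Fac`, τ-rigidity, bricks, etc. -/

variable (A : Type) [Ring A]

/-- `X` is a quotient module of `M`. -/
def IsQuotientOf (M X : ModuleCat.{0} A) : Prop :=
  ∃ f : M →ₗ[A] X, Function.Surjective f

open Classical in
/-- The dimension vector of a module `M`, relative to a family `S : Fin n → ModuleCat A`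
of (representatives of the isomorphism classes of the) simple `A`-modules: its `i`-th entry
is the multiplicity of `S i` as a composition factor of `M` (well defined by Jordan–Hölder,
for `M` of finite length). -/
noncomputable def dimVec {n : ℕ} (S : Fin n → ModuleCat.{0} A)
    (M : Type) [AddCommGroup M] [Module A M] : Fin n → ℕ := fun i =>
  if h : ∃ s : CompositionSeries (Submodule A M),
      RelSeries.head s = ⊥ ∧ RelSeries.last s = ⊤ then
    Nat.card {j : Fin h.choose.length //
      Nonempty ((↥(h.choose j.succ) ⧸
        (Submodule.comap (h.choose j.succ).subtype
          (h.choose j.castSucc))) ≃ₗ[A] S i)}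
  else 0

/-- The Newton polytope of `U`: the convex hull in `ℝⁿ` of the dimension vectors of
the quotient modules of `U`. -/
noncomputable def newtonPolytope {n : ℕ} (S : Fin n → ModuleCat.{0} A)
    (U : ModuleCat.{0} A) : Set (Fin n → ℝ) :=
  convexHull ℝ { v : Fin n → ℝ | ∃ p : Submodule A U,
    v = fun i => ((dimVec A S (↥U ⧸ p) i : ℕ) : ℝ) }

/-- `Fac M`: the class of quotient modules of finite direct sums of copies of `M`. -/
def Fac (M : ModuleCat.{0} A) : Set (ModuleCat.{0} A) :=
  { X | ∃ (k : ℕ) (f : (Fin k → M) →ₗ[A] X), Function.Surjective f }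

/-- A torsion class in `mod A`: a class of finite-dimensional `A`-modules closed under
isomorphisms, quotient modules and extensions. -/
def IsTorsionClass (T : Set (ModuleCat.{0} A)) : Prop :=
  (∀ M ∈ T, Module.Finite A M) ∧
  (∀ M ∈ T, ∀ N : ModuleCat.{0} A, Nonempty (M ≃ₗ[A] N) → N ∈ T) ∧
  (∀ M ∈ T, ∀ X : ModuleCat.{0} A, IsQuotientOf A M X → X ∈ T) ∧
  (∀ (L E N : ModuleCat.{0} A) (f : L →ₗ[A] E) (g : E →ₗ[A] N),
    Function.Injective f → Function.Surjective g →
    LinearMap.range f = LinearMap.ker g → L ∈ T → N ∈ T → E ∈ T)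

/-- `⟨N⟩_tors`, the smallest torsion class containing `N`. -/
def torsGen (N : ModuleCat.{0} A) : Set (ModuleCat.{0} A) :=
  ⋂₀ { T | IsTorsionClass A T ∧ N ∈ T }

/-- A module `N` is left finite if the torsion class it generates is functorially finite,
i.e. `⟨N⟩_tors = Fac M` for some `M` in `mod A`. -/
def LeftFinite (N : ModuleCat.{0} A) : Prop :=
  ∃ M : ModuleCat.{0} A, Module.Finite A M ∧ torsGen A N = Fac A M

/-- `M` is τ-rigid: `Ext¹(M, X) = 0` for every `X ∈ Fac M`, expressed by the splitting of
every short exact sequence `0 → X → E → M → 0`. -/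
def IsTauRigid (M : ModuleCat.{0} A) : Prop :=
  ∀ X ∈ Fac A M, ∀ (E : ModuleCat.{0} A) (f : X →ₗ[A] E) (g : E →ₗ[A] M),
    Function.Injective f → Function.Surjective g → LinearMap.range f = LinearMap.ker g →
    ∃ s : M →ₗ[A] E, g.comp s = LinearMap.id

/-- `M` is indecomposable. -/
def Indecomposable (M : ModuleCat.{0} A) : Prop :=
  Nontrivial M ∧ ∀ (M₁ M₂ : ModuleCat.{0} A),
    Nonempty (M ≃ₗ[A] (M₁ × M₂)) → (Subsingleton M₁ ∨ Subsingleton M₂)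

/-- `M` is a brick: its endomorphism ring is a division ring, i.e. `M ≠ 0` and every
nonzero endomorphism of `M` is invertible. -/
def IsBrick (M : ModuleCat.{0} A) : Prop :=
  Nontrivial M ∧ ∀ f : M →ₗ[A] M, f ≠ 0 → Function.Bijective f

/-- Over an Artinian ring every finitely generated module has a projective cover. -/
theorem exists_projective_superfluous_ker {R : Type*} [Ring R] [IsArtinianRing R]
    (X : Type*) [AddCommGroup X] [Module R X] [Module.Finite R X] :
    ∃ (k : ℕ) (Q : Submodule R (Fin k → R)) (π : Q →ₗ[R] X), Module.Projective R Q ∧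
      Function.Surjective π ∧
      ∀ N : Submodule R Q, N ⊔ LinearMap.ker π = ⊤ → N = ⊤ := by
  obtain ⟨k, π, hπ⟩ := Module.Finite.exists_fin' R X
  obtain ⟨Q, ⟨hQproj, hQ⟩, hmin⟩ := IsArtinian.set_has_minimal
    {Q : Submodule R (Fin k → R) | Module.Projective R Q ∧ Q.map π = ⊤}
    ⟨⊤, Module.Projective.of_equiv Submodule.topEquiv.symm, by
      rw [Submodule.map_top, LinearMap.range_eq_top.2 hπ]⟩
  have hsurj : Function.Surjective (π.domRestrict Q) := by
    intro x
    obtain ⟨q, hq, rfl⟩ : x ∈ Q.map π := hQ ▸ Submodule.mem_top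
    exact ⟨⟨q, hq⟩, rfl⟩
  refine ⟨k, Q, π.domRestrict Q, hQproj, hsurj, fun N hN => ?_⟩
  have hNsurj : Function.Surjective ((π.domRestrict Q).domRestrict N) := by
    intro x
    obtain ⟨q, rfl⟩ := hsurj x
    obtain ⟨a, ha, b, hb, rfl⟩ := Submodule.mem_sup.1 (hN ▸ Submodule.mem_top : q ∈ N ⊔ _)
    exact ⟨⟨a, ha⟩, by simpa using hb⟩
  obtain ⟨g, hg⟩ := Module.projective_lifting_property _ (π.domRestrict Q) hNsurj
  let e : Module.End R Q := N.subtype ∘ₗ g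
  have he : ∀ q, π.domRestrict Q (e q) = π.domRestrict Q q := fun q => LinearMap.congr_fun hg q
  have hepow : ∀ (m : ℕ) (q : Q), π.domRestrict Q ((e ^ m) q) = π.domRestrict Q q := by
    intro m
    induction m with
    | zero => simp
    | succ m ih => intro q; rw [pow_succ', Module.End.mul_apply, he, ih]
  obtain ⟨m, hm, hm1⟩ :=
    ((LinearMap.eventually_isCompl_ker_pow_range_pow e).and
      (Filter.eventually_ge_atTop 1)).exists
  have hrange : Module.Projective R (LinearMap.range (e ^ m)) :=
    Module.Projective.of_split (LinearMap.range (e ^ m)).subtype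
      (Submodule.projectionOnto _ _ hm.symm)
      (Submodule.projectionOnto_comp_subtype hm.symm)
  have hle : (LinearMap.range (e ^ m)).map Q.subtype ≤ Q := Submodule.map_subtype_le _ _
  have heq : (LinearMap.range (e ^ m)).map Q.subtype = Q := by
    by_contra hne
    refine hmin _ ⟨?_, ?_⟩ (lt_of_le_of_ne hle hne)
    · exact Module.Projective.of_equiv
        (Submodule.equivSubtypeMap Q (LinearMap.range (e ^ m)))
    · rw [eq_top_iff]
      rintro x -
      obtain ⟨q, rfl⟩ := hsurj x
      exact ⟨_, ⟨(e ^ m) q, ⟨q, rfl⟩, rfl⟩, hepow m q⟩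
  rw [eq_top_iff]
  rintro q -
  obtain ⟨r, ⟨s, rfl⟩, hr⟩ : (q : Fin k → R) ∈ (LinearMap.range (e ^ m)).map Q.subtype :=
    heq.ge q.2
  obtain rfl : (e ^ m) s = q := Subtype.ext hr
  obtain ⟨m, rfl⟩ := Nat.exists_eq_add_of_le' hm1
  rw [pow_succ', Module.End.mul_apply]
  exact (g _).2

section

variable {A}

/-- The torsion class generated by a finitely generated module is a torsion class. -/
theorem isTorsionClass_torsGen [IsArtinianRing A] (N : ModuleCat.{0} A) (hN : Module.Finite A N) :
    IsTorsionClass A (torsGen A N) := by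
  have hall : IsTorsionClass A {X | Module.Finite A X} := by
    refine ⟨fun _ h => h, ?_, ?_, ?_⟩
    · rintro M hM X ⟨e⟩
      have : Module.Finite A M := hM
      exact Module.Finite.equiv e
    · rintro M hM X ⟨f, hf⟩
      have : Module.Finite A M := hM
      exact Module.Finite.of_surjective f hf
    · intro L E N f g _ hg hfg hL hN
      have : Module.Finite A L := hL
      have : Module.Finite A N := hN
      have : Module.Finite A (LinearMap.ker g) := hfg ▸ inferInstance
      have := Module.Finite.equiv (g.quotKerEquivOfSurjective hg).symm
      exact Module.Finite.of_submodule_quotient (LinearMap.ker g)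
  refine ⟨fun M hM => hM _ ⟨hall, hN⟩, fun M hM X h T hT => hT.1.2.1 M (hM T hT) X h,
    fun M hM X h T hT => hT.1.2.2.1 M (hM T hT) X h,
    fun L E N f g hf hg hfg hL hN T hT => hT.1.2.2.2 L E N f g hf hg hfg (hL T hT) (hN T hT)⟩

namespace IsTorsionClass

variable {T : Set (ModuleCat.{0} A)}

theorem of_surjective (hT : IsTorsionClass A T) {X Y : Type} [AddCommGroup X] [Module A X]
    [AddCommGroup Y] [Module A Y] (hX : ModuleCat.of A X ∈ T) (f : X →ₗ[A] Y)
    (hf : Function.Surjective f) : ModuleCat.of A Y ∈ T :=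
  hT.2.2.1 _ hX _ ⟨f, hf⟩

theorem of_submodule_quotient (hT : IsTorsionClass A T) {X Y : Type} [AddCommGroup X] [Module A X]
    [AddCommGroup Y] [Module A Y] (g : X →ₗ[A] Y) (hg : Function.Surjective g)
    (hk : ModuleCat.of A (LinearMap.ker g) ∈ T) (hY : ModuleCat.of A Y ∈ T) :
    ModuleCat.of A X ∈ T :=
  hT.2.2.2 _ _ _ (LinearMap.ker g).subtype g (Submodule.subtype_injective _) hg
    (Submodule.range_subtype _) hk hY

/-- Every Noetherian module has a torsion submodule with torsion-free quotient. -/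
theorem exists_torsionFree_quotient (hT : IsTorsionClass A T)
    (h0 : ModuleCat.of A PUnit.{1} ∈ T) (V : Type) [AddCommGroup V] [Module A V]
    [IsNoetherian A V] :
    ∃ N : Submodule A V, ModuleCat.of A N ∈ T ∧
      ∀ X : Type, [AddCommGroup X] → [Module A X] → ModuleCat.of A X ∈ T →
        ∀ f : X →ₗ[A] V ⧸ N, f = 0 := by
  obtain ⟨N, hN, hmax⟩ := set_has_maximal_iff_noetherian.2 ‹IsNoetherian A V›
    {N | ModuleCat.of A N ∈ T} ⟨⊥, hT.of_surjective h0 (0 : PUnit →ₗ[A] (⊥ : Submodule A V))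
      fun x => ⟨0, Subsingleton.elim _ _⟩⟩
  refine ⟨N, hN, fun X _ _ hX f => ?_⟩
  by_contra hf
  let P : Submodule A V := (LinearMap.range f).comap N.mkQ
  have hNP : N ≤ P := fun x hx => by
    change N.mkQ x ∈ LinearMap.range f
    rw [Submodule.mkQ_apply, (Submodule.Quotient.mk_eq_zero N).2 hx]
    exact zero_mem _
  refine hmax P ?_ (lt_of_le_of_ne hNP fun h => hf ?_)
  · let g : P →ₗ[A] LinearMap.range f := N.mkQ.restrict fun _ hx => hx
    refine hT.of_submodule_quotient g ?_ ?_ (hT.of_surjective hX f.rangeRestrict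
      f.surjective_rangeRestrict)
    · rintro ⟨y, hy⟩
      obtain ⟨v, rfl⟩ := N.mkQ_surjective y
      exact ⟨⟨v, hy⟩, rfl⟩
    · have hmem : ∀ n : N, (⟨n, hNP n.2⟩ : P) ∈ LinearMap.ker g := fun n =>
        Subtype.ext ((Submodule.Quotient.mk_eq_zero N).2 n.2)
      refine hT.of_surjective hN ((Submodule.inclusion hNP).codRestrict _ hmem) ?_
      rintro ⟨⟨v, hv⟩, hgv⟩
      exact ⟨⟨v, (Submodule.Quotient.mk_eq_zero N).1 (congrArg Subtype.val hgv)⟩, rfl⟩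
  · ext x
    obtain ⟨v, hv⟩ := N.mkQ_surjective (f x)
    have hvP : v ∈ P := ⟨x, hv.symm⟩
    rw [← h] at hvP
    rw [← hv, Submodule.mkQ_apply, (Submodule.Quotient.mk_eq_zero N).2 hvP, LinearMap.zero_apply]

/-- If a torsion class is of the form `Fac M`, then the regular module has a minimal left
approximation in it, here recorded by the image `t` of `1`. -/
theorem exists_minimal_approximation (hT : IsTorsionClass A T) (K : Type) [Field K] [Algebra K A]
    [FiniteDimensional K A] [IsArtinianRing A]
    (M : ModuleCat.{0} A) (hM : Module.Finite A M) (hfac : T = Fac A M) :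
    ∃ (W : Type) (_ : AddCommGroup W) (_ : Module A W) (t : W), ModuleCat.of A W ∈ T ∧
      (∀ X : Type, [AddCommGroup X] → [Module A X] → ModuleCat.of A X ∈ T → ∀ x : X,
        ∃ h : W →ₗ[A] X, h t = x) ∧
      ∀ g : W →ₗ[A] W, g t = t → Function.Bijective g := by
  let _ : Module K M := Module.compHom M (algebraMap K A)
  have : IsScalarTower K A M := ⟨fun c a x => by
    rw [Algebra.smul_def, mul_smul]; rfl⟩
  have : Module.Finite K M := Module.Finite.trans A M
  obtain ⟨k, g, hg⟩ := Module.Finite.exists_fin' K M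
  let t : Fin k → M := fun i => g (Pi.single i 1)
  have ht : ∀ X : Type, [AddCommGroup X] → [Module A X] → ModuleCat.of A X ∈ T → ∀ x : X,
      ∃ h : (Fin k → M) →ₗ[A] X, h t = x := by
    intro X _ _ hX x
    rw [hfac] at hX
    obtain ⟨r, f, hf⟩ := hX
    obtain ⟨y, rfl⟩ := hf x
    choose c hc using fun j => hg (y j)
    refine ⟨f ∘ₗ LinearMap.pi fun j => ∑ i, c j i • LinearMap.proj i, ?_⟩
    rw [LinearMap.comp_apply]
    congr 1
    ext j
    rw [← hc j, LinearMap.pi_apply_eq_sum_univ g (c j)]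
    simp only [LinearMap.pi_apply, LinearMap.sum_apply, LinearMap.smul_apply, LinearMap.proj_apply]
    refine Finset.sum_congr rfl fun i _ => ?_
    congr 1
    refine congrArg g (funext fun l => ?_)
    simp [Pi.single_apply, eq_comm]
  have htop : ModuleCat.of A (Fin k → M) ∈ T := by
    rw [hfac]
    exact ⟨k, LinearMap.id, Function.surjective_id⟩
  obtain ⟨W, ⟨hWT, htW, hW⟩, hmin⟩ := IsArtinian.set_has_minimal
    {W : Submodule A (Fin k → M) | ModuleCat.of A W ∈ T ∧ t ∈ W ∧
      ∀ X : Type, [AddCommGroup X] → [Module A X] → ModuleCat.of A X ∈ T → ∀ x : X,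
        ∃ h : (Fin k → M) →ₗ[A] X, h t = x}
    ⟨⊤, hT.of_surjective htop Submodule.topEquiv.symm.toLinearMap
      Submodule.topEquiv.symm.surjective, Submodule.mem_top, ht⟩
  refine ⟨W, inferInstance, inferInstance, ⟨t, htW⟩, hWT, fun X _ _ hX x => ?_, fun g hg => ?_⟩
  · obtain ⟨h, hh⟩ := ht X hX x
    exact ⟨h.domRestrict W, hh⟩
  · apply IsNoetherian.bijective_of_surjective_endomorphism
    have heq : (LinearMap.range g).map W.subtype = W := by
      by_contra hne
      refine hmin ((LinearMap.range g).map W.subtype) ⟨?_, ⟨⟨t, htW⟩, ⟨_, hg⟩, rfl⟩, ht⟩ (lt_of_le_of_ne (Submodule.map_subtype_le _ _) hne)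
      exact hT.of_surjective hWT
        ((Submodule.equivSubtypeMap W (LinearMap.range g)).toLinearMap ∘ₗ g.rangeRestrict)
        ((Submodule.equivSubtypeMap W _).surjective.comp g.surjective_rangeRestrict)
    intro w
    obtain ⟨r, ⟨s, rfl⟩, hr⟩ : (w : Fin k → M) ∈ (LinearMap.range g).map W.subtype := heq.ge w.2
    exact ⟨s, Subtype.ext hr⟩

end IsTorsionClass

end

section

variable {A} {T : Set (ModuleCat.{0} A)} {W : Type} [AddCommGroup W] [Module A W] {t : W}
  {P₀ P₁ X : Type} [AddCommGroup P₀] [Module A P₀] [AddCommGroup P₁] [Module A P₁]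
  [AddCommGroup X] [Module A X]

namespace IsTorsionClass

theorem exists_sub_comp_mem_map_ker (hT : IsTorsionClass A T) (hWT : ModuleCat.of A W ∈ T)
    (happ : ∀ X : Type, [AddCommGroup X] → [Module A X] → ModuleCat.of A X ∈ T → ∀ x : X,
      ∃ h : W →ₗ[A] X, h t = x)
    (hmin : ∀ g : W →ₗ[A] W, g t = t → Function.Bijective g)
    [Module.Projective A P₀] (p : P₁ →ₗ[A] P₀) (q : P₀ →ₗ[A] W) (hq : Function.Surjective q)
    (hpq : LinearMap.range p = LinearMap.ker q) (hX : ModuleCat.of A X ∈ T) (φ : P₁ →ₗ[A] X) :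
    ∃ ψ : P₀ →ₗ[A] X, ∀ z, φ z - ψ (p z) ∈ (LinearMap.ker p).map φ := by
  have hqp : ∀ z, q (p z) = 0 := fun z => by
    rw [← LinearMap.mem_ker, ← hpq]; exact ⟨z, rfl⟩
  let R : Submodule A (X × P₀) := LinearMap.range (φ.prod (-p))
  let i : X →ₗ[A] (X × P₀) ⧸ R := R.mkQ ∘ₗ LinearMap.inl A X P₀
  let j : P₀ →ₗ[A] (X × P₀) ⧸ R := R.mkQ ∘ₗ LinearMap.inr A X P₀
  let π : (X × P₀) ⧸ R →ₗ[A] W := R.liftQ (q ∘ₗ LinearMap.snd A X P₀) (by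
    rintro _ ⟨z, rfl⟩
    simp [hqp])
  have hπj : ∀ y, π (j y) = q y := fun y => rfl
  have hπi : ∀ x, π (i x) = 0 := fun x => map_zero q
  have hij : ∀ z, i (φ z) = j (p z) := fun z => by
    refine (Submodule.Quotient.eq R).2 ⟨z, ?_⟩
    simp
  have hker : LinearMap.ker π ≤ LinearMap.range i := by
    intro e he
    obtain ⟨⟨x, y⟩, rfl⟩ := R.mkQ_surjective e
    have hxy : R.mkQ (x, y) = i x + j y := by
      change _ = R.mkQ (x, 0) + R.mkQ (0, y)
      rw [← map_add, Prod.mk_add_mk, add_zero, zero_add]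
    rw [LinearMap.mem_ker, hxy, map_add, hπi, hπj, zero_add, ← LinearMap.mem_ker, ← hpq] at he
    obtain ⟨z, rfl⟩ := he
    exact ⟨x + φ z, by rw [hxy, map_add, hij]⟩
  have hE : ModuleCat.of A ((X × P₀) ⧸ R) ∈ T := by
    refine hT.of_submodule_quotient π (fun w => ?_) ?_ hWT
    · obtain ⟨y, rfl⟩ := hq w
      exact ⟨j y, hπj y⟩
    · refine hT.of_surjective hX (i.codRestrict _ hπi) ?_
      rintro ⟨e, he⟩
      obtain ⟨x, rfl⟩ := hker he
      exact ⟨x, rfl⟩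
  obtain ⟨y₀, hy₀⟩ := hq t
  obtain ⟨h, hh⟩ := happ _ hE (j y₀)
  let b := LinearEquiv.ofBijective (π ∘ₗ h) (hmin (π ∘ₗ h) (by
    rw [LinearMap.comp_apply, hh, hπj, hy₀]))
  let s : W →ₗ[A] (X × P₀) ⧸ R := h ∘ₗ b.symm.toLinearMap
  have hs : ∀ w, π (s w) = w := fun w => b.apply_symm_apply w
  let d : P₀ →ₗ[A] LinearMap.range i := (j - s ∘ₗ q).codRestrict _ fun y => hker (by
    simp [hπj, hs])
  obtain ⟨ψ, hψ⟩ := Module.projective_lifting_property i.rangeRestrict d i.surjective_rangeRestrict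
  have hψ' : ∀ y, i (ψ y) = j y - s (q y) := fun y =>
    congrArg Subtype.val (LinearMap.congr_fun hψ y)
  refine ⟨ψ, fun z => ?_⟩
  have hz : i (φ z - ψ (p z)) = 0 := by
    rw [map_sub, hψ', hqp, map_zero, sub_zero, hij, sub_self]
  obtain ⟨k, hk⟩ := (Submodule.Quotient.mk_eq_zero R).1 hz
  have hk₁ : φ k = φ z - ψ (p z) := congrArg Prod.fst hk
  have hk₂ : -p k = 0 := congrArg Prod.snd hk
  exact ⟨k, neg_eq_zero.1 hk₂, hk₁⟩

/-- Morphisms from the first term of a minimal projective presentation of an Ext-projective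
module of a torsion class to a torsion module extend to the zeroth term. -/
theorem exists_comp_eq (hT : IsTorsionClass A T) (hWT : ModuleCat.of A W ∈ T)
    (happ : ∀ X : Type, [AddCommGroup X] → [Module A X] → ModuleCat.of A X ∈ T → ∀ x : X,
      ∃ h : W →ₗ[A] X, h t = x)
    (hmin : ∀ g : W →ₗ[A] W, g t = t → Function.Bijective g)
    [Module.Projective A P₀] (p : P₁ →ₗ[A] P₀) (q : P₀ →ₗ[A] W) (hq : Function.Surjective q)
    (hpq : LinearMap.range p = LinearMap.ker q)
    (hp : ∀ N : Submodule A P₁, N ⊔ LinearMap.ker p = ⊤ → N = ⊤) [IsArtinian A X]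
    (hX : ModuleCat.of A X ∈ T) (φ : P₁ →ₗ[A] X) :
    ∃ ψ : P₀ →ₗ[A] X, ψ ∘ₗ p = φ := by
  obtain ⟨_, ⟨ψ, rfl⟩, hψ⟩ := IsArtinian.set_has_minimal
    (Set.range fun ψ : P₀ →ₗ[A] X => LinearMap.range (φ - ψ ∘ₗ p)) ⟨_, 0, rfl⟩
  obtain ⟨χ, hχ⟩ := hT.exists_sub_comp_mem_map_ker hWT happ hmin p q hq hpq hX (φ - ψ ∘ₗ p)
  have hle : LinearMap.range (φ - (ψ + χ) ∘ₗ p) ≤ (LinearMap.ker p).map (φ - ψ ∘ₗ p) := by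
    rintro _ ⟨z, rfl⟩
    convert hχ z using 1
    simp [sub_sub]
  have hle' : (LinearMap.ker p).map (φ - ψ ∘ₗ p) ≤ LinearMap.range (φ - ψ ∘ₗ p) :=
    LinearMap.map_le_range
  have hge : LinearMap.range (φ - ψ ∘ₗ p) ≤ (LinearMap.ker p).map (φ - ψ ∘ₗ p) := by
    by_contra hne
    exact hψ _ ⟨ψ + χ, rfl⟩ ⟨hle.trans hle', fun h => hne (h.trans hle)⟩
  have htop : LinearMap.ker (φ - ψ ∘ₗ p) = ⊤ := by
    apply hp
    rw [eq_top_iff]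
    rintro z -
    obtain ⟨k, hk, hkz⟩ := hge ⟨z, rfl⟩
    refine Submodule.mem_sup.2 ⟨z - k, ?_, k, hk, sub_add_cancel _ _⟩
    rw [LinearMap.mem_ker, map_sub, hkz, sub_self]
  exact ⟨ψ, (sub_eq_zero.1 (LinearMap.ker_eq_top.1 htop)).symm⟩

end IsTorsionClass

end

section

variable {A} {K : Type} [Field K] [Algebra K A]
  {P : Type} [AddCommGroup P] [Module A P]

theorem finite_linearMap [FiniteDimensional K A] [Module.Finite A P]
    (X : Type) [AddCommGroup X] [Module A X] [Module K X] [IsScalarTower K A X]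
    [Module.Finite A X] : Module.Finite K (P →ₗ[A] X) := by
  have : Module.Finite K X := Module.Finite.trans A X
  obtain ⟨k, f, hf⟩ := Module.Finite.exists_fin' A P
  let g : (P →ₗ[A] X) →ₗ[K] (Fin k → X) :=
    { toFun := fun h i => h (f (Pi.single i 1))
      map_add' := fun _ _ => rfl
      map_smul' := fun _ _ => rfl }
  refine Module.Finite.of_injective g fun h₁ h₂ h => ?_
  have : h₁ ∘ₗ f = h₂ ∘ₗ f := LinearMap.pi_ext' fun i => LinearMap.ext_ring (congrFun h i)
  exact (LinearMap.cancel_right hf).1 this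

theorem finrank_linearMap_congr {X Y : Type} [AddCommGroup X] [Module A X] [Module K X]
    [IsScalarTower K A X] [AddCommGroup Y] [Module A Y] [Module K Y] [IsScalarTower K A Y]
    (e : X ≃ₗ[A] Y) :
    Module.finrank K (P →ₗ[A] X) = Module.finrank K (P →ₗ[A] Y) :=
  LinearEquiv.finrank_eq <| LinearEquiv.ofLinearMap
    (LinearMap.compRight K e.toLinearMap) (LinearMap.compRight K e.symm.toLinearMap)
    (by ext; simp) (by ext; simp)

theorem finrank_linearMap_eq_add_quotient [FiniteDimensional K A] [Module.Finite A P]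
    [Module.Projective A P] {X : Type} [AddCommGroup X] [Module A X] [Module K X]
    [IsScalarTower K A X] [Module.Finite A X] (N : Submodule A X) :
    Module.finrank K (P →ₗ[A] X) =
      Module.finrank K (P →ₗ[A] N) + Module.finrank K (P →ₗ[A] X ⧸ N) := by
  have := finite_linearMap (A := A) (K := K) (P := P) X
  let f : (P →ₗ[A] X) →ₗ[K] (P →ₗ[A] X ⧸ N) := LinearMap.compRight K N.mkQ
  let g : (P →ₗ[A] N) →ₗ[K] (P →ₗ[A] X) := LinearMap.compRight K N.subtype
  have hf : Function.Surjective f := fun h =>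
    Module.projective_lifting_property N.mkQ h N.mkQ_surjective
  have hg : Function.Injective g := fun _ _ h =>
    (LinearMap.cancel_left N.subtype_injective).1 h
  have hfg : LinearMap.ker f = LinearMap.range g := by
    ext h
    constructor
    · intro hh
      refine ⟨h.codRestrict N fun x => ?_, rfl⟩
      exact (Submodule.Quotient.mk_eq_zero N).1 (LinearMap.congr_fun hh x)
    · rintro ⟨h, rfl⟩
      ext x
      exact (Submodule.Quotient.mk_eq_zero N).2 (h x).2
  rw [← LinearMap.finrank_range_add_finrank_ker f, hfg, LinearMap.finrank_range_of_inj hg,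
    LinearMap.range_eq_top.2 hf, finrank_top, add_comm]

theorem eq_sum_of_succ_eq_add {m : ℕ} (g : Fin (m + 1) → ℕ) (d : Fin m → ℕ) (h0 : g 0 = 0)
    (h : ∀ j, g j.succ = g j.castSucc + d j) : g (Fin.last m) = ∑ j, d j := by
  induction m with
  | zero => simpa using h0
  | succ m ih =>
    rw [Fin.sum_univ_castSucc, ← Fin.succ_last, h]
    congr 1
    exact ih (fun j => g j.castSucc) (fun j => d j.castSucc) h0 fun j => h j.castSucc

/-- For a projective module `P`, the dimension of `Hom(P, X)` is a linear function of the
dimension vector of `X`. -/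
theorem finrank_linearMap_eq_sum_dimVec [FiniteDimensional K A] [IsArtinianRing A]
    [Module.Finite A P] [Module.Projective A P] {n : ℕ} (S : Fin n → ModuleCat.{0} A)
    [∀ i, Module K (S i)] [∀ i, IsScalarTower K A (S i)]
    (hdistinct : ∀ i j, Nonempty ((S i : Type) ≃ₗ[A] (S j : Type)) → i = j)
    (hcomplete : ∀ M : ModuleCat.{0} A, IsSimpleModule A M → ∃ i, Nonempty (M ≃ₗ[A] S i))
    (X : Type) [AddCommGroup X] [Module A X] [Module K X]
    [IsScalarTower K A X] [Module.Finite A X] :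
    Module.finrank K (P →ₗ[A] X) =
      ∑ i, dimVec A S X i * Module.finrank K (P →ₗ[A] S i) := by
  classical
  have hex : ∃ s : CompositionSeries (Submodule A X),
      RelSeries.head s = ⊥ ∧ RelSeries.last s = ⊤ :=
    exists_compositionSeries_of_isNoetherian_isArtinian A X
  simp only [dimVec, dif_pos hex]
  obtain ⟨hhead, hlast⟩ := hex.choose_spec
  generalize hex.choose = s at hhead hlast ⊢
  have hsucc : ∀ j : Fin s.length, Module.finrank K (P →ₗ[A] s j.succ) =
      Module.finrank K (P →ₗ[A] s j.castSucc) + ∑ i,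
        if Nonempty ((↥(s j.succ) ⧸
        (Submodule.comap (s j.succ).subtype (s j.castSucc))) ≃ₗ[A] S i)
        then Module.finrank K (P →ₗ[A] S i) else 0 := by
    intro j
    have hcov : s j.castSucc ⋖ s j.succ := s.step j
    rw [finrank_linearMap_eq_add_quotient (Submodule.comap (s j.succ).subtype (s j.castSucc)),
      finrank_linearMap_congr (Submodule.comapSubtypeEquivOfLe hcov.le)]
    congr 1
    obtain ⟨i, ⟨e⟩⟩ := hcomplete (ModuleCat.of A _) ((covBy_iff_quot_is_simple hcov.le).1 hcov)
    rw [finrank_linearMap_congr e, Finset.sum_eq_single i, if_pos ⟨e⟩]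
    · rintro i' - hi'
      exact if_neg fun ⟨e'⟩ => hi' (hdistinct _ _ ⟨e'.symm.trans e⟩)
    · simp
  have h0 : Module.finrank K (P →ₗ[A] s 0) = 0 := by
    have hs : s 0 = ⊥ := hhead
    rw [hs]
    exact Module.finrank_zero_of_subsingleton
  have hl : Module.finrank K (P →ₗ[A] s (Fin.last _)) = Module.finrank K (P →ₗ[A] X) := by
    have hs : s (Fin.last _) = ⊤ := hlast
    rw [hs]
    exact finrank_linearMap_congr Submodule.topEquiv
  rw [← hl, eq_sum_of_succ_eq_add (fun j => Module.finrank K (P →ₗ[A] s j)) _ h0 hsucc, Finset.sum_comm]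
  refine Finset.sum_congr rfl fun i _ => ?_
  rw [← Finset.sum_filter, Finset.sum_const, smul_eq_mul, Nat.card_eq_fintype_card,
    Fintype.card_subtype]

end

section

variable {A} {T : Set (ModuleCat.{0} A)}

/-- A torsion class of the form `Fac M` carries a linear functional that is positive on its nonzero
members and nonpositive on torsion-free modules. -/
theorem IsTorsionClass.exists_functional (hT : IsTorsionClass A T) (K : Type) [Field K] [Algebra K A]
    [FiniteDimensional K A] [IsArtinianRing A]
    (M : ModuleCat.{0} A) (hM : Module.Finite A M) (hfac : T = Fac A M)
    {n : ℕ} (S : Fin n → ModuleCat.{0} A)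
    (hdistinct : ∀ i j, Nonempty ((S i : Type) ≃ₗ[A] (S j : Type)) → i = j)
    (hcomplete : ∀ M : ModuleCat.{0} A, IsSimpleModule A M → ∃ i, Nonempty (M ≃ₗ[A] S i)) :
    ∃ θ : (Fin n → ℝ) →ₗ[ℝ] ℝ,
      (∀ X : Type, [AddCommGroup X] → [Module A X] → [Nontrivial X] → ModuleCat.of A X ∈ T →
        0 < θ fun i => (dimVec A S X i : ℝ)) ∧
      ∀ Y : Type, [AddCommGroup Y] → [Module A Y] → [Module.Finite A Y] →
        (∀ X : Type, [AddCommGroup X] → [Module A X] → ModuleCat.of A X ∈ T →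
          ∀ f : X →ₗ[A] Y, f = 0) → θ (fun i => (dimVec A S Y i : ℝ)) ≤ 0 := by
  obtain ⟨W, _, _, t, hWT, happ, hmin⟩ := hT.exists_minimal_approximation K M hM hfac
  have hWfin : Module.Finite A W := hT.1 _ hWT
  obtain ⟨k, q, hq⟩ := Module.Finite.exists_fin' A W
  obtain ⟨l, P₁, r, hP₁, hr, hsup⟩ := exists_projective_superfluous_ker (R := A) (LinearMap.ker q)
  let p : P₁ →ₗ[A] (Fin k → A) := (LinearMap.ker q).subtype ∘ₗ r
  have hpq : LinearMap.range p = LinearMap.ker q := by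
    rw [LinearMap.range_comp, LinearMap.range_eq_top.2 hr, Submodule.map_top,
      Submodule.range_subtype]
  have hkp : LinearMap.ker p = LinearMap.ker r :=
    LinearMap.ker_comp_of_ker_eq_bot _ (Submodule.ker_subtype _)
  rw [← hkp] at hsup
  let _ : ∀ i, Module K (S i) := fun i => Module.compHom (S i) (algebraMap K A)
  have _ : ∀ i, IsScalarTower K A (S i) := fun i => ⟨fun c a x => by
    rw [Algebra.smul_def, mul_smul]; rfl⟩
  let θ : (Fin n → ℝ) →ₗ[ℝ] ℝ := ∑ i, ((Module.finrank K ((Fin k → A) →ₗ[A] S i) : ℝ) -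
    Module.finrank K (P₁ →ₗ[A] S i)) • LinearMap.proj i
  have hθ : ∀ X : Type, ∀ [AddCommGroup X] [Module A X] [Module K X] [IsScalarTower K A X]
      [Module.Finite A X], θ (fun i => (dimVec A S X i : ℝ)) =
      Module.finrank K ((Fin k → A) →ₗ[A] X) - Module.finrank K (P₁ →ₗ[A] X) := by
    intro X _ _ _ _ _
    rw [finrank_linearMap_eq_sum_dimVec S hdistinct hcomplete X,
      finrank_linearMap_eq_sum_dimVec S hdistinct hcomplete X]
    push_cast
    rw [← Finset.sum_sub_distrib]
    simp only [θ, LinearMap.sum_apply, LinearMap.smul_apply, LinearMap.proj_apply, smul_eq_mul]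
    exact Finset.sum_congr rfl fun i _ => by ring
  refine ⟨θ, fun X _ _ _ hX => ?_, fun Y _ _ _ hY => ?_⟩
  · let _ : Module K X := Module.compHom X (algebraMap K A)
    have : IsScalarTower K A X := ⟨fun c a x => by rw [Algebra.smul_def, mul_smul]; rfl⟩
    have : Module.Finite A X := hT.1 _ hX
    have := finite_linearMap (A := A) (K := K) (P := Fin k → A) X
    rw [hθ X, sub_pos, Nat.cast_lt]
    let F : ((Fin k → A) →ₗ[A] X) →ₗ[K] (P₁ →ₗ[A] X) := LinearMap.lcomp K X p
    have hF : LinearMap.range F = ⊤ := LinearMap.range_eq_top.2 fun φ =>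
      hT.exists_comp_eq hWT happ hmin p q hq hpq hsup hX φ
    obtain ⟨x, hx⟩ := exists_ne (0 : X)
    obtain ⟨h, rfl⟩ := happ X hX x
    have hker : LinearMap.ker F ≠ ⊥ := by
      intro hbot
      have hmem : h ∘ₗ q ∈ LinearMap.ker F := by
        ext z
        have : q (p z) = 0 := (r z).2
        simp [F, this]
      rw [hbot, Submodule.mem_bot] at hmem
      obtain ⟨y, rfl⟩ := hq t
      exact hx (LinearMap.congr_fun hmem y)
    have hpos : 0 < Module.finrank K (LinearMap.ker F) :=
      Submodule.one_le_finrank_iff.2 hker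
    rw [← LinearMap.finrank_range_add_finrank_ker F, hF, finrank_top]
    exact Nat.lt_add_of_pos_right hpos
  · let _ : Module K Y := Module.compHom Y (algebraMap K A)
    have : IsScalarTower K A Y := ⟨fun c a x => by rw [Algebra.smul_def, mul_smul]; rfl⟩
    rw [hθ Y, sub_nonpos, Nat.cast_le]
    have := finite_linearMap (A := A) (K := K) (P := P₁) Y
    let F : ((Fin k → A) →ₗ[A] Y) →ₗ[K] (P₁ →ₗ[A] Y) := LinearMap.lcomp K Y p
    refine LinearMap.finrank_le_finrank_of_injective (f := F) (LinearMap.ker_eq_bot.1 ?_)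
    rw [eq_bot_iff]
    intro f hf
    have hle : LinearMap.ker q ≤ LinearMap.ker f := by
      rw [← hpq]
      rintro _ ⟨z, rfl⟩
      exact LinearMap.congr_fun hf z
    have h0 := hY _ hWT ((LinearMap.ker q).liftQ f hle ∘ₗ
      (q.quotKerEquivOfSurjective hq).symm.toLinearMap)
    refine (Submodule.mem_bot K).2 (LinearMap.ext fun y => ?_)
    have hy := LinearMap.congr_fun h0 (q y)
    have hqy : (q.quotKerEquivOfSurjective hq).symm (q y) = (LinearMap.ker q).mkQ y :=
      (LinearEquiv.symm_apply_eq _).2 rfl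
    simpa [hqy] using hy

/-- A module whose dimension vector vanishes is zero. -/
theorem subsingleton_of_dimVec_eq_zero (K : Type) [Field K] [Algebra K A]
    [FiniteDimensional K A] [IsArtinianRing A]
    {n : ℕ} (S : Fin n → ModuleCat.{0} A)
    (hdistinct : ∀ i j, Nonempty ((S i : Type) ≃ₗ[A] (S j : Type)) → i = j)
    (hcomplete : ∀ M : ModuleCat.{0} A, IsSimpleModule A M → ∃ i, Nonempty (M ≃ₗ[A] S i))
    (X : Type) [AddCommGroup X] [Module A X] [Module K X] [IsScalarTower K A X]
    [Module.Finite A X] (h : dimVec A S X = 0) : Subsingleton X := by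
  let _ : ∀ i, Module K (S i) := fun i => Module.compHom (S i) (algebraMap K A)
  have _ : ∀ i, IsScalarTower K A (S i) := fun i => ⟨fun c a x => by
    rw [Algebra.smul_def, mul_smul]; rfl⟩
  have hX := finrank_linearMap_eq_sum_dimVec (K := K) (P := A) S hdistinct hcomplete X
  have := finite_linearMap (A := A) (K := K) (P := A) X
  rw [h] at hX
  have hsub : Subsingleton (A →ₗ[A] X) := Module.finrank_zero_iff.1 (by simpa using hX)
  exact ⟨fun x y => by
    simpa using LinearMap.congr_fun
      (Subsingleton.elim (LinearMap.toSpanSingleton A X x) (LinearMap.toSpanSingleton A X y)) 1⟩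

/-- Membership in a torsion class of the form `Fac M` is detected by Newton polytopes. -/
theorem IsTorsionClass.mem_of_newtonPolytope_subset (hT : IsTorsionClass A T) (K : Type) [Field K] [Algebra K A]
    [FiniteDimensional K A] [IsArtinianRing A]
    (M : ModuleCat.{0} A) (hM : Module.Finite A M) (hfac : T = Fac A M)
    {n : ℕ} (S : Fin n → ModuleCat.{0} A)
    (hdistinct : ∀ i j, Nonempty ((S i : Type) ≃ₗ[A] (S j : Type)) → i = j)
    (hcomplete : ∀ M : ModuleCat.{0} A, IsSimpleModule A M → ∃ i, Nonempty (M ≃ₗ[A] S i))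
    {U V : ModuleCat.{0} A} (hU : U ∈ T) (hV : Module.Finite A V)
    (hUV : newtonPolytope A S V ⊆ newtonPolytope A S U) : V ∈ T := by
  obtain ⟨θ, hpos, hneg⟩ := hT.exists_functional K M hM hfac S hdistinct hcomplete
  have h0 : ModuleCat.of A PUnit.{1} ∈ T :=
    hT.2.2.1 U hU _ ⟨0, fun x => ⟨0, Subsingleton.elim _ _⟩⟩
  obtain ⟨N, hN, hY⟩ := hT.exists_torsionFree_quotient h0 V
  have hdim0 : ∀ X : Type, ∀ [AddCommGroup X] [Module A X] [Subsingleton X],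
      (fun i => (dimVec A S X i : ℝ)) = 0 := by
    intro X _ _ _
    ext i
    by_contra hne
    unfold dimVec at hne
    split_ifs at hne with hex
    · have : IsEmpty (Fin hex.choose.length) := ⟨fun j =>
        (hex.choose.step j).lt.ne (Subsingleton.elim _ _)⟩
      simp at hne
    · simp at hne
  have hconv : Convex ℝ {v : Fin n → ℝ | v = 0 ∨ 0 < θ v} := by
    rw [convex_iff_forall_pos]
    rintro v hv w hw a b ha hb -
    rcases hv with rfl | hv <;> rcases hw with rfl | hw
    · left; simp
    · right; simpa using mul_pos hb hw
    · right; simpa using mul_pos ha hv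
    · right; simpa using add_pos (mul_pos ha hv) (mul_pos hb hw)
  have hsub : newtonPolytope A S U ⊆ {v : Fin n → ℝ | v = 0 ∨ 0 < θ v} := by
    refine convexHull_min ?_ hconv
    rintro _ ⟨p, rfl⟩
    rcases subsingleton_or_nontrivial (U ⧸ p) with _ | _
    · exact Or.inl (hdim0 _)
    · exact Or.inr (hpos _ (hT.2.2.1 U hU _ ⟨p.mkQ, p.mkQ_surjective⟩))
  have hmem : (fun i => (dimVec A S (V ⧸ N) i : ℝ)) ∈ newtonPolytope A S V :=
    subset_convexHull ℝ _ ⟨N, rfl⟩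
  rcases hsub (hUV hmem) with hzero | hlt
  · let _ : Module K (V ⧸ N) := Module.compHom (V ⧸ N) (algebraMap K A)
    have : IsScalarTower K A (V ⧸ N) := ⟨fun c a x => by rw [Algebra.smul_def, mul_smul]; rfl⟩
    have hss := subsingleton_of_dimVec_eq_zero K S hdistinct hcomplete (V ⧸ N) (by
      ext i
      exact Nat.cast_eq_zero.1 (congrFun hzero i))
    have hNtop : N = ⊤ := Submodule.Quotient.subsingleton_iff.1 hss
    subst hNtop
    exact hT.2.1 _ hN V ⟨Submodule.topEquiv⟩
  · exact absurd hlt (not_lt.2 (hneg _ hY))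

end

/-- left finite modules with the same Newton polytope generate the same
torsion class. -/
theorem torsGen_eq_of_newtonPolytope_eq (A : Type) [Ring A]
    (K : Type) [Field K] [Algebra K A] [FiniteDimensional K A]
    (n : ℕ) (S : Fin n → ModuleCat.{0} A)
    (hsimple : ∀ i, IsSimpleModule A (S i))
    (hdistinct : ∀ i j, Nonempty ((S i : Type) ≃ₗ[A] (S j : Type)) → i = j)
    (hcomplete : ∀ M : ModuleCat.{0} A, IsSimpleModule A M → ∃ i, Nonempty (M ≃ₗ[A] S i))
    (U V : ModuleCat.{0} A) (hU : Module.Finite A U) (hV : Module.Finite A V)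
    (hUlf : LeftFinite A U) (hVlf : LeftFinite A V)
    (hNewton : newtonPolytope A S U = newtonPolytope A S V) :
    torsGen A U = torsGen A V := by
  have : IsArtinianRing A := IsArtinianRing.of_finite K A
  have hle : ∀ X Y : ModuleCat.{0} A, Module.Finite A X → Module.Finite A Y → LeftFinite A X →
      newtonPolytope A S X = newtonPolytope A S Y → torsGen A Y ⊆ torsGen A X := by
    rintro X Y hX hY ⟨M, hM, hfac⟩ h Z hZ
    have hT := isTorsionClass_torsGen X hX
    exact hZ _ ⟨hT, hT.mem_of_newtonPolytope_subset K M hM hfac S hdistinct hcomplete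
      (fun _ hT' => hT'.2) hY h.ge⟩
  exact (hle V U hV hU hVlf hNewton.symm).antisymm (hle U V hU hV hUlf hNewton)
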